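/- Let n ≥ 10 and let C_1, …, C_{n−1} ∈ GL_r(ℂ) be an irreducible representation of B_n of dimension r with n+1 ≤ r ≤ 2n−9. Then there exist a nonzero complex number y, an integer k with 3 ≤ k ≤ n−7, and invertible matrices Ĉ_1, …, Ĉ_{n−1} ∈ GL_r(ℂ) forming an irreducible representation of B_n of dimension r with corank k (that is, rank(Ĉ_1 − I) = k), such that C_i = y·Ĉ_i for all i = 1, …, n−1. -/

import Mathlib

namespace BraidRed

open Module

/-- A (finite-dimensional) representation of the braid group `B_m`, as operators
`C 1, …, C (m-1)`. -/
structure BRep {V : Type} [AddCommGroup V] [Module ℂ V] (m : ℕ) (C : ℕ → End ℂ V) : Prop where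
  inj : ∀ i, 1 ≤ i → i < m → Function.Injective (C i)
  comm : ∀ i j, 1 ≤ i → i + 2 ≤ j → j < m → C i * C j = C j * C i
  braid : ∀ i, 1 ≤ i → i + 1 < m → C i * C (i + 1) * C i = C (i + 1) * C i * C (i + 1)

/-- All generators act in the same way. -/
def Triv {V : Type} [AddCommGroup V] [Module ℂ V] (m : ℕ) (C : ℕ → End ℂ V) : Prop :=
  ∀ i j, 1 ≤ i → i < m → 1 ≤ j → j < m → C i = C j

/-- Irreducibility. -/
def Irr {V : Type} [AddCommGroup V] [Module ℂ V] (m : ℕ) (C : ℕ → End ℂ V) : Prop :=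
  ∀ p : Submodule ℂ V, (∀ i, 1 ≤ i → i < m → ∀ v ∈ p, C i v ∈ p) → p = ⊥ ∨ p = ⊤

/-- Every representation of `B_m` of dimension at most `d` is trivial. -/
def Pd (m d : ℕ) : Prop :=
  ∀ (V : Type) [AddCommGroup V] [Module ℂ V] [FiniteDimensional ℂ V] (C : ℕ → End ℂ V),
    BRep m C → finrank ℂ V ≤ d → Triv m C

section basics

variable {V : Type} [AddCommGroup V] [Module ℂ V]

theorem end_cancel {a x y : End ℂ V} (ha : Function.Injective a) (h : a * x = a * y) : x = y := by
  ext v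
  apply ha
  exact LinearMap.congr_fun h v

theorem eq_of_comm_braid {a b : End ℂ V} (ha : Function.Injective a) (hb : Function.Injective b)
    (h1 : a * b = b * a) (h2 : a * b * a = b * a * b) : a = b := by
  rw [← h1] at h2
  exact end_cancel (a := a * b) (ha.comp hb) h2

theorem triv_of_eq {m : ℕ} {C : ℕ → End ℂ V} (h : BRep m C) {k : ℕ} (hk : 1 ≤ k) (hkm : k + 1 < m)
    (e : C k = C (k + 1)) : Triv m C := by
  have up : ∀ i, 1 ≤ i → i + 2 < m → C i = C (i + 1) → C (i + 1) = C (i + 2) := by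
    intro i hi him hh
    refine eq_of_comm_braid (h.inj _ (by omega) (by omega)) (h.inj _ (by omega) (by omega)) ?_
      (h.braid (i + 1) (by omega) (by omega))
    rw [← hh]; exact h.comm i (i + 2) hi le_rfl him
  have down : ∀ i, 1 ≤ i → i + 2 < m → C (i + 1) = C (i + 2) → C i = C (i + 1) := by
    intro i hi him hh
    refine eq_of_comm_braid (h.inj _ (by omega) (by omega)) (h.inj _ (by omega) (by omega)) ?_
      (h.braid i (by omega) (by omega))
    rw [hh]; exact h.comm i (i + 2) hi le_rfl him
  have h1 : ∀ j, j + 1 ≤ k → C (k - j) = C (k - j + 1) := by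
    intro j
    induction j with
    | zero => intro _; simpa using e
    | succ j ih =>
      intro hj
      have := ih (by omega)
      apply down _ (by omega) (by omega)
      have e1 : k - (j + 1) + 1 = k - j := by omega
      have e2 : k - (j + 1) + 2 = k - j + 1 := by omega
      rw [e1, e2]; exact this
  have h2 : C 1 = C 2 := by
    have := h1 (k - 1) (by omega)
    rw [show k - (k - 1) = 1 by omega] at this
    exact this
  have h3 : ∀ j, 1 ≤ j → j + 1 < m → C j = C (j + 1) := by
    intro j hj
    induction j, hj using Nat.le_induction with
    | base => intro _; exact h2
    | succ j hj ih => intro hm; exact up j hj hm (ih (by omega))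
  have h4 : ∀ j, 1 ≤ j → j < m → C j = C 1 := by
    intro j hj
    induction j, hj using Nat.le_induction with
    | base => intro _; rfl
    | succ j hj ih => intro hm; rw [← h3 j hj hm]; exact ih (by omega)
  intro i j hi hi' hj hj'
  rw [h4 i hi hi', h4 j hj hj']

/-- Extension lemma: if all products of two differences vanish, the representation is trivial. -/
theorem triv_of_mul_zero {m : ℕ} {C : ℕ → End ℂ V} (h : BRep m C) (hm : 5 ≤ m)
    (hz : ∀ a b c d, 1 ≤ a → a < m → 1 ≤ b → b < m → 1 ≤ c → c < m → 1 ≤ d → d < m →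
      (C a - C b) * (C c - C d) = 0) : Triv m C := by
  apply triv_of_eq h (k := 1) le_rfl (by omega)
  have hPP := hz 1 4 1 4 (by omega) (by omega) (by omega) (by omega) (by omega) (by omega)
    (by omega) (by omega)
  have hPQ := hz 1 4 2 4 (by omega) (by omega) (by omega) (by omega) (by omega) (by omega)
    (by omega) (by omega)
  have hQP := hz 2 4 1 4 (by omega) (by omega) (by omega) (by omega) (by omega) (by omega)
    (by omega) (by omega)
  have hQQ := hz 2 4 2 4 (by omega) (by omega) (by omega) (by omega) (by omega) (by omega)
    (by omega) (by omega)
  have c1 := h.comm 1 4 (by omega) (by omega) (by omega)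
  have c2 := h.comm 2 4 (by omega) (by omega) (by omega)
  have hb := h.braid 1 (by omega) (by omega)
  have hc := h.inj 4 (by omega) (by omega)
  simp only [Nat.reduceAdd] at hb ⊢
  generalize C 1 = a at *
  generalize C 2 = b at *
  generalize C 4 = c at *
  obtain ⟨P, rfl⟩ : ∃ P, a = c + P := ⟨a - c, by abel⟩
  obtain ⟨Q, rfl⟩ : ∃ Q, b = c + Q := ⟨b - c, by abel⟩
  simp only [add_sub_cancel_left] at hPP hPQ hQP hQQ
  have d1 : P * c = c * P := by
    simp only [mul_add, add_mul] at c1; exact add_left_cancel c1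
  have d2 : Q * c = c * Q := by
    simp only [mul_add, add_mul] at c2; exact add_left_cancel c2
  have e1 : (c + P) * (c + Q) * (c + P) = c * (c * c) + c * (c * (P + P + Q)) := by
    have : (c + P) * (c + Q) * (c + P) = c * (c * c) + c * (c * P) + c * (Q * c) + c * (Q * P)
      + (P * c) * c + (P * c) * P + (P * Q) * c + (P * Q) * P := by noncomm_ring
    rw [this, hQP, hPQ, d1, d2, mul_assoc c P c, d1, mul_assoc c P P, hPP]
    noncomm_ring
  have e2 : (c + Q) * (c + P) * (c + Q) = c * (c * c) + c * (c * (Q + Q + P)) := by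
    have : (c + Q) * (c + P) * (c + Q) = c * (c * c) + c * (c * Q) + c * (P * c) + c * (P * Q)
      + (Q * c) * c + (Q * c) * Q + (Q * P) * c + (Q * P) * Q := by noncomm_ring
    rw [this, hQP, hPQ, d1, d2, mul_assoc c Q c, d2, mul_assoc c Q Q, hQQ]
    noncomm_ring
  rw [e1, e2] at hb
  have := end_cancel hc (end_cancel hc (add_left_cancel hb))
  have h3 : P + P + Q = P + Q + P := by abel
  have h4 : Q + Q + P = P + Q + Q := by abel
  rw [h3, h4] at this
  rw [add_left_cancel this]

theorem exists_restrict {m : ℕ} {C : ℕ → End ℂ V} (h : BRep m C) (S : Submodule ℂ V)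
    (hS : ∀ i, 1 ≤ i → i < m → ∀ v ∈ S, C i v ∈ S) :
    ∃ C' : ℕ → End ℂ S, BRep m C' ∧ ∀ i, 1 ≤ i → i < m → ∀ v : S, (C' i v : V) = C i v := by
  classical
  let C' : ℕ → End ℂ S := fun i =>
    if hh : ∀ v ∈ S, C i v ∈ S then (C i).restrict hh else 1
  have key : ∀ i, 1 ≤ i → i < m → ∀ v : S, (C' i v : V) = C i v := by
    intro i h1 h2 v
    simp only [C']
    rw [dif_pos (hS i h1 h2)]
    rfl
  refine ⟨C', ⟨?_, ?_, ?_⟩, key⟩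
  · intro i h1 h2 v w hvw
    apply Subtype.ext
    apply h.inj i h1 h2
    rw [← key i h1 h2, ← key i h1 h2, hvw]
  · intro i j h1 h2 h3
    ext v
    have := LinearMap.congr_fun (h.comm i j h1 h2 h3) (v : V)
    simp only [Module.End.mul_apply] at this ⊢
    rw [key i h1 (by omega), key j (by omega) h3, key j (by omega) h3, key i h1 (by omega)]
    exact this
  · intro i h1 h2
    ext v
    have := LinearMap.congr_fun (h.braid i h1 h2) (v : V)
    simp only [Module.End.mul_apply] at this ⊢
    rw [key i h1 (by omega), key (i+1) (by omega) h2, key i h1 (by omega),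
      key (i+1) (by omega) h2, key i h1 (by omega), key (i+1) (by omega) h2]
    exact this

theorem exists_quot [FiniteDimensional ℂ V] {m : ℕ} {C : ℕ → End ℂ V} (h : BRep m C)
    (S : Submodule ℂ V) (hS : ∀ i, 1 ≤ i → i < m → ∀ v ∈ S, C i v ∈ S) :
    ∃ C' : ℕ → End ℂ (V ⧸ S), BRep m C' ∧
      ∀ i, 1 ≤ i → i < m → ∀ v : V, C' i (S.mkQ v) = S.mkQ (C i v) := by
  classical
  let C' : ℕ → End ℂ (V ⧸ S) := fun i =>
    if hh : S ≤ S.comap (C i) then S.mapQ S (C i) hh else 1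
  have key : ∀ i, 1 ≤ i → i < m → ∀ v : V, C' i (S.mkQ v) = S.mkQ (C i v) := by
    intro i h1 h2 v
    have hh : S ≤ S.comap (C i) := fun v hv => hS i h1 h2 v hv
    simp only [C']
    rw [dif_pos hh]
    rfl
  refine ⟨C', ⟨?_, ?_, ?_⟩, key⟩
  · intro i h1 h2
    apply LinearMap.injective_iff_surjective.mpr
    intro w
    obtain ⟨w, rfl⟩ := S.mkQ_surjective w
    obtain ⟨v, rfl⟩ := LinearMap.injective_iff_surjective.mp (h.inj i h1 h2) w
    exact ⟨S.mkQ v, key i h1 h2 v⟩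
  · intro i j h1 h2 h3
    apply LinearMap.ext
    intro v
    obtain ⟨v, rfl⟩ := S.mkQ_surjective v
    have := LinearMap.congr_fun (h.comm i j h1 h2 h3) (v : V)
    simp only [Module.End.mul_apply] at this ⊢
    rw [key j (by omega) h3, key i h1 (by omega), key i h1 (by omega), key j (by omega) h3, this]
  · intro i h1 h2
    apply LinearMap.ext
    intro v
    obtain ⟨v, rfl⟩ := S.mkQ_surjective v
    have := LinearMap.congr_fun (h.braid i h1 h2) (v : V)
    simp only [Module.End.mul_apply] at this ⊢
    rw [key i h1 (by omega), key (i+1) (by omega) h2, key i h1 (by omega),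
      key (i+1) (by omega) h2, key i h1 (by omega), key (i+1) (by omega) h2, this]

theorem brep_shift {m : ℕ} {C : ℕ → End ℂ V} (h : BRep (m + 2) C) :
    BRep m (fun i => C (i + 2)) := by
  refine ⟨?_, ?_, ?_⟩
  · intro i h1 h2; exact h.inj _ (by omega) (by omega)
  · intro i j h1 h2 h3; exact h.comm _ _ (by omega) (by omega) (by omega)
  · intro i h1 h2; exact h.braid (i + 2) (by omega) (by omega)

theorem brep_le {m m' : ℕ} {C : ℕ → End ℂ V} (h : BRep m C) (hm : m' ≤ m) :
    BRep m' C := by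
  refine ⟨?_, ?_, ?_⟩
  · intro i h1 h2; exact h.inj _ (by omega) (by omega)
  · intro i j h1 h2 h3; exact h.comm _ _ (by omega) (by omega) (by omega)
  · intro i h1 h2; exact h.braid _ (by omega) (by omega)

theorem brep_smul {m : ℕ} {C : ℕ → End ℂ V} (h : BRep m C) {c : ℂ} (hc : c ≠ 0) :
    BRep m (fun i => c • C i) := by
  refine ⟨?_, ?_, ?_⟩
  · intro i h1 h2 v w hvw
    apply h.inj _ h1 h2
    simp only [LinearMap.smul_apply] at hvw
    exact smul_right_injective V hc hvw
  · intro i j h1 h2 h3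
    simp only [smul_mul_smul_comm]
    rw [h.comm _ _ h1 h2 h3]
  · intro i h1 h2
    simp only [smul_mul_smul_comm]
    rw [h.braid _ h1 h2]

theorem irr_smul {m : ℕ} {C : ℕ → End ℂ V} (h : Irr m C) {c : ℂ} (hc : c ≠ 0) :
    Irr m (fun i => c • C i) := by
  intro p hp
  apply h p
  intro i h1 h2 v hv
  have := p.smul_mem c⁻¹ (hp i h1 h2 v hv)
  simpa [smul_smul, inv_mul_cancel₀ hc] using this

theorem pd_one (m : ℕ) : Pd m 1 := by
  intro V _ _ _ C h hd
  by_cases hm : 3 ≤ m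
  · apply triv_of_eq h (k := 1) le_rfl (by omega)
    refine eq_of_comm_braid (h.inj _ (by omega) (by omega)) (h.inj _ (by omega) (by omega)) ?_
      (h.braid 1 (by omega) (by omega))
    obtain ⟨v, hv⟩ := finrank_le_one_iff.mp hd
    obtain ⟨a, ha⟩ := hv (C 1 v)
    obtain ⟨b, hb⟩ := hv (C (1+1) v)
    ext w
    obtain ⟨c, rfl⟩ := hv w
    simp only [Module.End.mul_apply, map_smul, ← ha, ← hb]
    simp only [smul_smul]; congr 1; ring
  · intro i j h1 h2 h3 h4
    rw [show i = j by omega]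

/-- If an operator commutes with a representation of `B_m`, `m ≥ 5`, which is trivial on all its
eigenspaces, then the representation is trivial. -/
theorem triv_of_eigen {m : ℕ} (hm : 5 ≤ m) (d : ℕ) :
    ∀ (V : Type) [AddCommGroup V] [Module ℂ V] [FiniteDimensional ℂ V] (C : ℕ → End ℂ V)
      (N : End ℂ V), BRep m C → finrank ℂ V ≤ d →
      (∀ i, 1 ≤ i → i < m → N * C i = C i * N) →
      (∀ (μ : ℂ) (v : V), N v = μ • v → ∀ i j, 1 ≤ i → i < m → 1 ≤ j → j < m → C i v = C j v) →
      Triv m C := by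
  induction d with
  | zero =>
    intro V _ _ _ C N h hd _ _
    exact pd_one m V C h (by omega)
  | succ d ih =>
    intro V _ _ _ C N h hd hN he
    rcases subsingleton_or_nontrivial V with hV | hV
    · intro i j _ _ _ _; ext v; exact Subsingleton.elim _ _
    obtain ⟨μ, hμ⟩ := Module.End.exists_eigenvalue N
    obtain ⟨v0, hv0⟩ := hμ.exists_hasEigenvector
    set M : End ℂ V := N - algebraMap ℂ (End ℂ V) μ with hM
    have hMv : ∀ v, M v = N v - μ • v := by intro v; simp [hM]
    have hMC : ∀ i, 1 ≤ i → i < m → ∀ v, M (C i v) = C i (M v) := by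
      intro i h1 h2 v
      have := LinearMap.congr_fun (hN i h1 h2) v
      simp only [Module.End.mul_apply] at this
      rw [hMv, hMv, this]; simp
    have hMN : ∀ v, N (M v) = M (N v) := by
      intro v; rw [hMv, hMv]; simp
    have hker : M v0 = 0 := by rw [hMv, hv0.apply_eq_smul]; simp
    have hlt : finrank ℂ (LinearMap.range M) ≤ d := by
      have h1 := LinearMap.finrank_range_add_finrank_ker M
      have h2 : 0 < finrank ℂ (LinearMap.ker M) := by
        rw [Module.finrank_pos_iff, Submodule.nontrivial_iff_ne_bot]
        intro hb
        exact hv0.2 (by rw [← Submodule.mem_bot ℂ, ← hb]; exact hker)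
      omega
    have hinv : ∀ i, 1 ≤ i → i < m → ∀ v ∈ LinearMap.range M, C i v ∈ LinearMap.range M := by
      rintro i h1 h2 _ ⟨w, rfl⟩
      exact ⟨C i w, hMC i h1 h2 w⟩
    obtain ⟨C', hC', key⟩ := exists_restrict h (LinearMap.range M) hinv
    have hinvN : ∀ v ∈ LinearMap.range M, N v ∈ LinearMap.range M := by
      rintro _ ⟨w, rfl⟩
      exact ⟨N w, (hMN w).symm⟩
    have ht : Triv m C' := by
      apply ih _ C' (N.restrict hinvN) hC' hlt
      · intro i h1 h2
        ext v
        simp only [Module.End.mul_apply, LinearMap.coe_restrict_apply]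
        rw [key i h1 h2, key i h1 h2]
        exact LinearMap.congr_fun (hN i h1 h2) (v : V)
      · intro ν v hv i j h1 h2 h3 h4
        apply Subtype.ext
        rw [key i h1 h2, key j h3 h4]
        apply he ν _ _ i j h1 h2 h3 h4
        have := congrArg Subtype.val hv
        simpa using this
    apply triv_of_mul_zero h hm
    intro a b c e ha ha' hb hb' hc hc' hd hd'
    ext v
    simp only [Module.End.mul_apply, LinearMap.sub_apply, LinearMap.zero_apply]
    rw [sub_eq_zero]
    apply he μ _ _ a b ha ha' hb hb'
    rw [← sub_eq_zero, ← hMv, map_sub, hMC c hc hc', hMC e hd hd', sub_eq_zero]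
    have := ht c e hc hc' hd hd'
    have h5 := congrArg Subtype.val (LinearMap.congr_fun this ⟨M v, v, rfl⟩)
    rw [key c hc hc', key e hd hd'] at h5
    exact h5

end basics


section more

variable {V : Type} [AddCommGroup V] [Module ℂ V]

theorem triv_on_range [FiniteDimensional ℂ V] {m d : ℕ} {C : ℕ → End ℂ V} (h : BRep m C)
    (hP : Pd m d) (S : Submodule ℂ V) (hS : ∀ i, 1 ≤ i → i < m → ∀ v ∈ S, C i v ∈ S)
    (hd : finrank ℂ S ≤ d) (i j : ℕ) (h1 : 1 ≤ i) (h2 : i < m) (h3 : 1 ≤ j) (h4 : j < m)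
    (v : V) (hv : v ∈ S) : C i v = C j v := by
  obtain ⟨C', hC', key⟩ := exists_restrict h S hS
  have ht := hP S C' hC' hd i j h1 h2 h3 h4
  have := congrArg Subtype.val (LinearMap.congr_fun ht ⟨v, hv⟩)
  rw [key i h1 h2, key j h3 h4] at this
  exact this

/-- Some eigenspace of `C 1` is large. -/
theorem exists_large_eigen [FiniteDimensional ℂ V] {m d : ℕ} {C : ℕ → End ℂ V}
    (h : BRep (m + 2) C) (hm : 5 ≤ m) (hP : Pd m d) (hnt : ¬ Triv (m + 2) C) :
    ∃ μ : ℂ, d < finrank ℂ (LinearMap.ker (C 1 - algebraMap ℂ (End ℂ V) μ)) := by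
  by_contra hcon
  push Not at hcon
  apply hnt
  have hs := brep_shift h
  have hcomm : ∀ i, 1 ≤ i → i < m → C 1 * C (i + 2) = C (i + 2) * C 1 := by
    intro i h1 h2
    exact h.comm _ _ (by omega) (by omega) (by omega)
  have ht : Triv m (fun i => C (i + 2)) := by
    apply triv_of_eigen hm (finrank ℂ V) V _ (C 1) hs le_rfl hcomm
    intro μ v hv i j h1 h2 h3 h4
    apply triv_on_range hs hP _ _ (hcon μ) i j h1 h2 h3 h4 v
    · simp [hv]
    · intro i h1 h2 w hw
      have := LinearMap.congr_fun (hcomm i h1 h2) w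
      simp only [Module.End.mul_apply] at this
      have hw' : C 1 w = μ • w := by
        simpa [sub_eq_zero] using hw
      simp only [LinearMap.mem_ker, LinearMap.sub_apply, Module.algebraMap_end_apply]
      rw [this, hw', map_smul, sub_self]
  exact triv_of_eq h (k := 3) (by omega) (by omega)
    (ht 1 2 (by omega) (by omega) (by omega) (by omega))

theorem conj_step {m : ℕ} {C : ℕ → End ℂ V} (h : BRep m C) {i : ℕ} (hi : 1 ≤ i) (him : i + 1 < m)
    (μ : ℂ) : (C i * C (i + 1)) * (C i - algebraMap ℂ (End ℂ V) μ) =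
      (C (i + 1) - algebraMap ℂ (End ℂ V) μ) * (C i * C (i + 1)) := by
  rw [mul_sub, sub_mul, h.braid i hi him, mul_assoc, ← Algebra.commutes μ]

theorem finrank_ker_step [FiniteDimensional ℂ V] {m : ℕ} {C : ℕ → End ℂ V} (h : BRep m C) (μ : ℂ)
    {i : ℕ} (hi : 1 ≤ i) (him : i < m) :
    finrank ℂ (LinearMap.range (C i - algebraMap ℂ (End ℂ V) μ)) =
      finrank ℂ (LinearMap.range (C 1 - algebraMap ℂ (End ℂ V) μ)) := by
  induction i, hi using Nat.le_induction with
  | base => rfl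
  | succ i hi ih =>
    rw [← ih (by omega)]
    have hc := conj_step h hi him μ
    have hinj : Function.Injective (C i * C (i + 1)) :=
      (h.inj i hi (by omega)).comp (h.inj (i + 1) (by omega) him)
    have hsurj := LinearMap.injective_iff_surjective.mp hinj
    have : LinearMap.range (C (i + 1) - algebraMap ℂ (End ℂ V) μ) =
        (LinearMap.range (C i - algebraMap ℂ (End ℂ V) μ)).map (C i * C (i + 1)) := by
      rw [← LinearMap.range_comp]
      have e : (C i * C (i + 1)) ∘ₗ (C i - algebraMap ℂ (End ℂ V) μ) =
        (C (i + 1) - algebraMap ℂ (End ℂ V) μ) ∘ₗ (C i * C (i + 1)) := hc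
      rw [e, LinearMap.range_comp_of_range_eq_top _ (LinearMap.range_eq_top.mpr hsurj)]
    rw [this]
    exact (LinearEquiv.finrank_eq (Submodule.equivMapOfInjective _ hinj _)).symm

theorem schur [FiniteDimensional ℂ V] [Nontrivial V] {m : ℕ} {C : ℕ → End ℂ V}
    (hirr : Irr m C) (X : End ℂ V) (hX : ∀ i, 1 ≤ i → i < m → X * C i = C i * X) :
    ∃ μ : ℂ, ∀ v, X v = μ • v := by
  obtain ⟨μ, hμ⟩ := Module.End.exists_eigenvalue X
  obtain ⟨v0, hv0⟩ := hμ.exists_hasEigenvector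
  refine ⟨μ, ?_⟩
  rcases hirr (Module.End.eigenspace X μ) (by
    intro i h1 h2 v hv
    rw [Module.End.mem_eigenspace_iff] at hv ⊢
    have := LinearMap.congr_fun (hX i h1 h2) v
    simp only [Module.End.mul_apply] at this
    rw [this, hv, map_smul]) with hb | ht
  · exact absurd hb hμ
  · intro v
    rw [← Module.End.mem_eigenspace_iff, ht]; trivial

theorem far_zero [FiniteDimensional ℂ V] {m d : ℕ} {C : ℕ → End ℂ V}
    (h : BRep (m + 2) C) (hirr : Irr (m + 2) C) (hm : 3 ≤ m) (hP : Pd m d)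
    (hr : finrank ℂ (LinearMap.range (C 1 - 1 : End ℂ V)) ≤ d) (hni : ¬ Function.Injective (C 1 - 1 : End ℂ V)) :
    ∀ i j, 1 ≤ i → i + 2 ≤ j → j < m + 2 → (C i - 1) * (C j - 1) = 0 := by
  have hnt : Nontrivial V := by
    by_contra hc
    rw [not_nontrivial_iff_subsingleton] at hc
    exact hni (Function.injective_of_subsingleton _)
  -- commutation of the operators
  have hAA : ∀ i j, 1 ≤ i → i + 2 ≤ j → j < m + 2 → (C i - 1) * (C j - 1) = (C j - 1) * (C i - 1) := by
    intro i j h1 h2 h3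
    have := h.comm i j h1 h2 h3
    simp only [mul_sub, sub_mul, this]; noncomm_ring
  have hAC : ∀ i j, 1 ≤ i → i + 2 ≤ j → j < m + 2 → (C i - 1) * C j = C j * (C i - 1) := by
    intro i j h1 h2 h3
    have := h.comm i j h1 h2 h3
    simp only [mul_sub, sub_mul, this]; noncomm_ring
  have hCA : ∀ i j, 1 ≤ i → i + 2 ≤ j → j < m + 2 → C i * (C j - 1) = (C j - 1) * C i := by
    intro i j h1 h2 h3
    have := h.comm i j h1 h2 h3
    simp only [mul_sub, sub_mul, this]; noncomm_ring
  have hr' : finrank ℂ (LinearMap.range (C (m + 1) - 1 : End ℂ V)) ≤ d := by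
    have := finrank_ker_step h 1 (i := m + 1) (by omega) (by omega)
    rw [map_one] at this
    omega
  -- left end
  have hL : ∀ j, 3 ≤ j → j < m + 2 → (C 1 - 1) * (C j - 1) = (C 1 - 1) * (C 3 - 1) := by
    intro j h1 h2
    rw [hAA 1 j (by omega) (by omega) (by omega), hAA 1 3 (by omega) (by omega) (by omega)]
    ext v
    have := triv_on_range (brep_shift h) hP (LinearMap.range (C 1 - 1 : End ℂ V)) (by
      rintro i hi hi' _ ⟨w, rfl⟩
      exact ⟨C (i + 2) w, LinearMap.congr_fun (hAC 1 (i + 2) (by omega) (by omega) (by omega)) w⟩)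
      hr (j - 2) 1 (by omega) (by omega) (by omega) (by omega) ((C 1 - 1) v) ⟨v, rfl⟩
    rw [show j - 2 + 2 = j by omega] at this
    simp only [Module.End.mul_apply]
    rw [LinearMap.sub_apply (C j), LinearMap.sub_apply (C 3), this]
  have hR : ∀ j, 1 ≤ j → j < m → (C j - 1) * (C (m + 1) - 1) = (C 1 - 1) * (C (m + 1) - 1) := by
    intro j h1 h2
    ext v
    have := triv_on_range (brep_le h (m' := m) (by omega)) hP (LinearMap.range (C (m + 1) - 1 : End ℂ V)) (by
      rintro i hi hi' _ ⟨w, rfl⟩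
      exact ⟨C i w,
        (LinearMap.congr_fun (hCA i (m + 1) (by omega) (by omega) (by omega)) w).symm⟩)
      hr' j 1 (by omega) (by omega) (by omega) (by omega) ((C (m + 1) - 1) v) ⟨v, rfl⟩
    simp only [Module.End.mul_apply]
    rw [LinearMap.sub_apply (C j), LinearMap.sub_apply (C 1), this]
  set X := (C 1 - 1) * (C 3 - 1) with hX
  have hXC : ∀ i, 1 ≤ i → i < m + 2 → X * C i = C i * X := by
    intro i h1 h2
    have hs : ∀ j, (C j - 1) * C j = C j * (C j - 1) := by intro j; noncomm_ring
    rcases Nat.lt_or_ge i 3 with hi | hi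
    · rcases (show i = 1 ∨ i = 2 by omega) with rfl | rfl
      · rw [hX, mul_assoc, ← hCA 1 3 (by omega) (by omega) (by omega), ← mul_assoc, hs, mul_assoc]
      · rw [← hL (m + 1) (by omega) (by omega), ← hR 2 (by omega) (by omega), mul_assoc,
          ← hCA 2 (m + 1) (by omega) (by omega) (by omega), ← mul_assoc, hs, mul_assoc]
    · rw [← hL i hi h2, mul_assoc, hs, ← mul_assoc, hAC 1 i (by omega) (by omega) h2, mul_assoc]
  obtain ⟨μ, hμ⟩ := schur hirr X hXC
  have hμ0 : μ = 0 := by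
    by_contra hne
    apply hni
    intro v w hvw
    have : X v = X w := by
      rw [hX, hAA 1 3 (by omega) (by omega) (by omega), Module.End.mul_apply, Module.End.mul_apply,
        hvw]
    rw [hμ, hμ] at this
    exact smul_right_injective V hne this
  have hX0 : X = 0 := by
    ext v; rw [hμ, hμ0]; simp
  intro i j hi
  induction i, hi using Nat.le_induction generalizing j with
  | base => intro h2 h3; rw [hL j (by omega) h3, hX0]
  | succ i hi ih =>
    intro h2 h3
    have hz := ih j (by omega) h3
    have hc := conj_step h hi (by omega) 1
    rw [map_one] at hc
    have hinj : Function.Injective (C i * C (i + 1)) :=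
      (h.inj i hi (by omega)).comp (h.inj (i + 1) (by omega) (by omega))
    have hsurj := LinearMap.injective_iff_surjective.mp hinj
    have hDj : (C i * C (i + 1)) * (C j - 1) = (C j - 1) * (C i * C (i + 1)) := by
      rw [mul_assoc, hCA (i + 1) j (by omega) (by omega) h3, ← mul_assoc,
        hCA i j (by omega) (by omega) h3, mul_assoc]
    have : (C (i + 1) - 1) * (C j - 1) * (C i * C (i + 1)) = 0 := by
      rw [mul_assoc, ← hDj, ← mul_assoc, ← hc, mul_assoc, hz, mul_zero]
    ext v
    obtain ⟨w, rfl⟩ := hsurj v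
    exact LinearMap.congr_fun this w

/-- The braid relation in terms of `A = C - 1`. -/
theorem braid_A {a b : End ℂ V} (h : a * b * a = b * a * b) :
    (a - 1) + (a - 1) * (a - 1) + (a - 1) * (b - 1) * (a - 1) =
      (b - 1) + (b - 1) * (b - 1) + (b - 1) * (a - 1) * (b - 1) := by
  have e1 : (a - 1) + (a - 1) * (a - 1) + (a - 1) * (b - 1) * (a - 1) =
    a * b * a - a * b - b * a + a + b - 1 := by noncomm_ring
  have e2 : (b - 1) + (b - 1) * (b - 1) + (b - 1) * (a - 1) * (b - 1) =
    b * a * b - a * b - b * a + a + b - 1 := by noncomm_ring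
  rw [e1, e2, h]

theorem eq_of_A_mul_zero [FiniteDimensional ℂ V] {m : ℕ} {C : ℕ → End ℂ V} (h : BRep m C) {i : ℕ}
    (hi : 1 ≤ i) (him : i + 1 < m) (hz : (C i - 1) * (C (i + 1) - 1) = 0) : C i = C (i + 1) := by
  have hb := h.braid i hi him
  have ha := h.inj i hi (by omega)
  have hb' := h.inj (i + 1) (by omega) him
  generalize C i = a at *
  generalize C (i + 1) = b at *
  have hinj : Function.Injective (a * b * a) := (ha.comp hb').comp ha
  have hsurj := LinearMap.injective_iff_surjective.mp hinj
  have hz' : (b - 1) * (a - 1) = 0 := by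
    have : (b - 1) * (a - 1) * (a * b * a) = 0 := by
      have e1 : (a - 1) * (a * b * a) = (a * b * a) * (b - 1) := by
        have : (a - 1) * (a * b * a) = a * (a * b * a) - a * b * a := by noncomm_ring
        rw [this, hb, mul_sub, ← hb]
        have : a * b * a * b = a * (b * a * b) := by noncomm_ring
        rw [this, hb]; noncomm_ring
      have e2 : (b - 1) * (a * b * a) = (a * b * a) * (a - 1) := by
        have : (b - 1) * (a * b * a) = (b * a * b) * a - a * b * a := by noncomm_ring
        rw [this, ← hb]; noncomm_ring
      rw [mul_assoc, e1, ← mul_assoc, e2, mul_assoc, hz, mul_zero]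
    ext v
    obtain ⟨w, rfl⟩ := hsurj v
    exact LinearMap.congr_fun this w
  have hA := braid_A hb
  rw [hz, hz'] at hA
  simp only [zero_mul, add_zero] at hA
  have f1 : (a - 1) * (a - 1) = 0 := by
    apply end_cancel ha
    have := congrArg (fun x => (a - 1) * x) hA
    simp only [mul_add] at this
    rw [← mul_assoc (a - 1) (b - 1), hz] at this
    simp only [zero_mul, add_zero] at this
    rw [mul_zero, ← this]; noncomm_ring
  have f2 : (b - 1) * (b - 1) = 0 := by
    apply end_cancel hb'
    have := congrArg (fun x => (b - 1) * x) hA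
    simp only [mul_add] at this
    rw [← mul_assoc (b - 1) (a - 1), hz'] at this
    simp only [zero_mul, add_zero] at this
    rw [mul_zero, this]; noncomm_ring
  rw [f1, f2, add_zero, add_zero] at hA
  exact sub_left_injective hA

theorem chain_bound [FiniteDimensional ℂ V] {m : ℕ} {C : ℕ → End ℂ V} (h : BRep m C) (hm : 3 ≤ m)
    (hz : ∀ i j, 1 ≤ i → i + 2 ≤ j → j < m → (C i - 1) * (C j - 1) = 0) (hnt : ¬ Triv m C) :
    m ≤ finrank ℂ V + 2 := by
  let K : ℕ → Submodule ℂ V := fun j => ⨅ i ∈ Finset.Icc 1 j, LinearMap.ker (C i - 1 : End ℂ V)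
  have hK : ∀ j v, v ∈ K j ↔ ∀ i, 1 ≤ i → i ≤ j → (C i - 1) v = 0 := by
    intro j v
    simp [K, Submodule.mem_iInf]
  have hlt : ∀ j, j + 2 < m → K (j + 1) < K j := by
    intro j hj
    refine lt_of_le_of_ne ?_ ?_
    · intro v hv
      rw [hK] at hv ⊢
      intro i h1 h2; exact hv i h1 (by omega)
    · intro he
      apply hnt
      rcases Nat.eq_zero_or_pos j with rfl | hj0
      · apply triv_of_eq h (k := 1) le_rfl (by omega)
        apply eq_of_A_mul_zero h le_rfl (by omega)
        ext v
        have : (C (1 + 1) - 1) v ∈ K 0 := by rw [hK]; intro i h1 h2; omega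
        rw [← he, hK] at this
        exact this 1 le_rfl le_rfl
      · apply triv_of_eq h (k := j + 1) (by omega) (by omega)
        apply eq_of_A_mul_zero h (by omega) (by omega)
        ext v
        have : (C (j + 1 + 1) - 1) v ∈ K j := by
          rw [hK]; intro i h1 h2
          exact LinearMap.congr_fun (hz i (j + 2) h1 (by omega) (by omega)) v
        rw [← he, hK] at this
        exact this (j + 1) (by omega) le_rfl
  have hdim : ∀ j, j + 2 ≤ m → finrank ℂ (K j) + j ≤ finrank ℂ V := by
    intro j
    induction j with
    | zero => intro _; simpa using Submodule.finrank_le (K 0)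
    | succ j ih =>
      intro hj
      have h1 := ih (by omega)
      have h2 := Submodule.finrank_lt_finrank_of_lt (hlt j (by omega))
      omega
  have := hdim (m - 2) (by omega)
  omega

end more

section final

variable {V : Type} [AddCommGroup V] [Module ℂ V]

theorem exists_smul_of_finrank_le_one [FiniteDimensional ℂ V] (S : Submodule ℂ V)
    (hS : finrank ℂ S ≤ 1) {k w : V} (hk : k ∈ S) (hk0 : k ≠ 0) (hw : w ∈ S) :
    ∃ c : ℂ, w = c • k := by
  obtain ⟨v, hv⟩ := finrank_le_one_iff.mp hS
  obtain ⟨a, ha⟩ := hv ⟨k, hk⟩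
  obtain ⟨b, hb⟩ := hv ⟨w, hw⟩
  have ha' : a • (v : V) = k := congrArg Subtype.val ha
  have hb' : b • (v : V) = w := congrArg Subtype.val hb
  have ha0 : a ≠ 0 := by
    rintro rfl
    exact hk0 (by rw [← ha', zero_smul])
  refine ⟨b * a⁻¹, ?_⟩
  rw [← ha', ← hb', smul_smul, mul_assoc, inv_mul_cancel₀ ha0, mul_one]

theorem finrank_le_of_inv [FiniteDimensional ℂ V] {m : ℕ} {C : ℕ → End ℂ V} (hirr : Irr m C)
    (N : ℕ) (e : ℕ → V) (i0 : ℕ) (hi0 : i0 < N) (he : e i0 ≠ 0)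
    (hinv : ∀ j, 1 ≤ j → j < m → ∀ i, i < N →
      C j (e i) ∈ Submodule.span ℂ (Set.image e (Set.Iio N))) :
    finrank ℂ V ≤ N := by
  classical
  have hmem : ∀ i, i < N → e i ∈ (Set.image e (Set.Iio N)) := by
    intro i hi
    exact ⟨i, hi, rfl⟩
  rcases hirr (Submodule.span ℂ (Set.image e (Set.Iio N))) (by
    intro j h1 h2 v hv
    induction hv using Submodule.span_induction with
    | mem x hx =>
      obtain ⟨i, hi, rfl⟩ := hx
      exact hinv j h1 h2 i hi
    | zero => simp
    | add x y _ _ hx hy => rw [map_add]; exact Submodule.add_mem _ hx hy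
    | smul a x _ hx => rw [map_smul]; exact Submodule.smul_mem _ _ hx) with hb | ht
  · exfalso
    apply he
    rw [← Submodule.mem_bot ℂ, ← hb]
    exact Submodule.subset_span (hmem i0 hi0)
  · have h1 := finrank_span_finset_le_card (R := ℂ) ((Finset.range N).image e)
    rw [Set.finrank, Finset.coe_image, Finset.coe_range, ht, finrank_top] at h1
    exact h1.trans (Finset.card_image_le.trans (by simp))

theorem finrank_le_one_of_line [FiniteDimensional ℂ V] {m : ℕ} {C : ℕ → End ℂ V} (hirr : Irr m C)
    {k : V} (hk : k ≠ 0) (h : ∀ j, 1 ≤ j → j < m → ∃ c : ℂ, C j k = c • k) :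
    finrank ℂ V ≤ 1 := by
  apply finrank_le_of_inv hirr 1 (fun _ => k) 0 (by omega) hk
  intro j h1 h2 i hi
  obtain ⟨c, hc⟩ := h j h1 h2
  rw [hc]
  apply Submodule.smul_mem
  apply Submodule.subset_span
  exact ⟨0, by simp, rfl⟩

theorem six_case [FiniteDimensional ℂ V] {C : ℕ → End ℂ V} (h : BRep 6 C) (hirr : Irr 6 C)
    (hnt : ¬ Triv 6 C) :
    ∃ μ : ℂ, 1 < finrank ℂ (LinearMap.ker (C 1 - algebraMap ℂ (End ℂ V) μ)) := by
  by_contra hcon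
  push Not at hcon
  apply hnt
  rcases subsingleton_or_nontrivial V with hV | hV
  · intro i j _ _ _ _; ext v; exact Subsingleton.elim _ _
  obtain ⟨μ, hμ⟩ := Module.End.exists_eigenvalue (C 1)
  obtain ⟨k, hk⟩ := hμ.exists_hasEigenvector
  have hk1 := hk.apply_eq_smul
  have hk0 := hk.2
  have hker : ∀ i, 1 ≤ i → i < 6 → ∀ (ν : ℂ) (w : V), C i k = ν • k → C i w = ν • w →
      ∃ c : ℂ, w = c • k := by
    intro i h1 h2 ν w hk hw
    have hd : finrank ℂ (LinearMap.ker (C i - algebraMap ℂ (End ℂ V) ν)) ≤ 1 := by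
      have e1 := finrank_ker_step h ν h1 h2
      have e2 := LinearMap.finrank_range_add_finrank_ker (C i - algebraMap ℂ (End ℂ V) ν)
      have e3 := LinearMap.finrank_range_add_finrank_ker (C 1 - algebraMap ℂ (End ℂ V) ν)
      have := hcon ν
      omega
    exact exists_smul_of_finrank_le_one _ hd (by simp [hk]) hk0 (by simp [hw])
  have hcc : ∀ i j, 1 ≤ i → i + 2 ≤ j → j < 6 → ∀ v, C i (C j v) = C j (C i v) := by
    intro i j h1 h2 h3 v
    exact LinearMap.congr_fun (h.comm i j h1 h2 h3) v
  have h3 : ∀ j, 3 ≤ j → j < 6 → ∃ c : ℂ, C j k = c • k := by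
    intro j h1 h2
    apply hker 1 (by omega) (by omega) μ _ hk1
    rw [hcc 1 j (by omega) (by omega) h2, hk1, map_smul]
  obtain ⟨γ, hγ⟩ := h3 5 (by omega) (by omega)
  have h2 : ∃ c : ℂ, C 2 k = c • k := by
    apply hker 5 (by omega) (by omega) γ _ hγ
    rw [← hcc 2 5 (by omega) (by omega) (by omega), hγ, map_smul]
  apply pd_one 6 V C h
  apply finrank_le_one_of_line hirr hk0
  intro j hj1 hj2
  rcases (show j = 1 ∨ j = 2 ∨ 3 ≤ j by omega) with rfl | rfl | hj
  · exact ⟨μ, hk1⟩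
  · exact h2
  · exact h3 j hj hj2

/-- Normalising the big eigenvalue to one. -/
theorem normalise [FiniteDimensional ℂ V] {m : ℕ} {C : ℕ → End ℂ V} (h : BRep m C) (hm : 2 ≤ m)
    (hirr : Irr m C) (hnt : ¬ Triv m C) (μ : ℂ)
    (hμ : 0 < finrank ℂ (LinearMap.ker (C 1 - algebraMap ℂ (End ℂ V) μ))) :
    ∃ C' : ℕ → End ℂ V, BRep m C' ∧ Irr m C' ∧ ¬ Triv m C' ∧
      LinearMap.ker (C' 1 - 1 : End ℂ V) = LinearMap.ker (C 1 - algebraMap ℂ (End ℂ V) μ) := by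
  have hμ0 : μ ≠ 0 := by
    rintro rfl
    rw [map_zero, sub_zero, LinearMap.ker_eq_bot.mpr (h.inj 1 le_rfl (by omega))] at hμ
    simp at hμ
  refine ⟨fun i => μ⁻¹ • C i, brep_smul h (inv_ne_zero hμ0), irr_smul hirr (inv_ne_zero hμ0), ?_, ?_⟩
  · intro ht
    apply hnt
    intro i j h1 h2 h3 h4
    exact smul_right_injective (End ℂ V) (inv_ne_zero hμ0) (ht i j h1 h2 h3 h4)
  · ext v
    simp only [LinearMap.mem_ker, LinearMap.sub_apply, LinearMap.smul_apply, Module.End.one_apply,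
      Module.algebraMap_end_apply, sub_eq_zero]
    rw [inv_smul_eq_iff₀ hμ0]

theorem not_inj_of_ker {A : End ℂ V} (h : 0 < finrank ℂ (LinearMap.ker A)) :
    ¬ Function.Injective A := by
  intro hi
  rw [LinearMap.ker_eq_bot.mpr hi] at h
  simp at h

theorem pd_main (m : ℕ) : 5 ≤ m → Pd m (m - 3) := by
  induction m using Nat.strong_induction_on with
  | _ m ihm =>
  intro hm
  have key : ∀ d, d ≤ m - 3 → Pd m d := by
    intro d
    induction d with
    | zero =>
      intro _ V _ _ _ C h hd
      exact pd_one m V C h (by omega)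
    | succ d ih =>
      intro hdm V _ _ _ C h hd
      by_cases hirr : Irr m C
      · by_contra hnt
        have hex : ∃ μ : ℂ,
            m - 5 < finrank ℂ (LinearMap.ker (C 1 - algebraMap ℂ (End ℂ V) μ)) := by
          rcases (show m = 5 ∨ m = 6 ∨ 7 ≤ m by omega) with rfl | rfl | hm7
          · rcases subsingleton_or_nontrivial V with hV | hV
            · exact absurd (fun i j _ _ _ _ => by ext v; exact Subsingleton.elim _ _) hnt
            obtain ⟨μ, hμ⟩ := Module.End.exists_eigenvalue (C 1)
            obtain ⟨k, hk⟩ := hμ.exists_hasEigenvector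
            refine ⟨μ, ?_⟩
            rw [Nat.sub_self, Module.finrank_pos_iff, Submodule.nontrivial_iff_ne_bot]
            intro hb
            apply hk.2
            rw [← Submodule.mem_bot ℂ, ← hb]
            simp [hk.apply_eq_smul]
          · exact six_case h hirr hnt
          · obtain ⟨m', rfl⟩ : ∃ m', m = m' + 2 := ⟨m - 2, by omega⟩
            have := exists_large_eigen h (by omega) (ihm m' (by omega) (by omega)) hnt
            rw [show m' + 2 - 5 = m' - 3 by omega]
            exact this
        obtain ⟨μ, hμ⟩ := hex
        obtain ⟨C', hC', hirr', hnt', hk⟩ := normalise h (by omega) hirr hnt μ (by omega)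
        rw [← hk] at hμ
        have e := LinearMap.finrank_range_add_finrank_ker (C' 1 - 1 : End ℂ V)
        obtain ⟨m', rfl⟩ : ∃ m', m = m' + 2 := ⟨m - 2, by omega⟩
        have hz := far_zero hC' hirr' (by omega) (pd_one m') (by omega)
          (not_inj_of_ker (by omega))
        have := chain_bound hC' (by omega) hz hnt'
        omega
      · simp only [Irr, not_forall, not_or] at hirr
        obtain ⟨p, hp, hpb, hpt⟩ := hirr
        have d1 : finrank ℂ p < finrank ℂ V := Submodule.finrank_lt hpt
        have d2 := Submodule.finrank_quotient_add_finrank p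
        have d3 : 0 < finrank ℂ p := by
          rw [Module.finrank_pos_iff, Submodule.nontrivial_iff_ne_bot]; exact hpb
        obtain ⟨C1, hC1, k1⟩ := exists_restrict h p hp
        obtain ⟨C2, hC2, k2⟩ := exists_quot h p hp
        have t1 := ih (by omega) p C1 hC1 (by omega)
        have t2 := ih (by omega) (V ⧸ p) C2 hC2 (by omega)
        apply triv_of_mul_zero h hm
        intro a b c e ha ha' hb hb' hc hc' he he'
        ext v
        have hmem : (C c - C e) v ∈ p := by
          have := LinearMap.congr_fun (t2 c e hc hc' he he') (p.mkQ v)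
          rw [k2 c hc hc', k2 e he he', ← sub_eq_zero, ← map_sub] at this
          exact (Submodule.Quotient.mk_eq_zero p).mp this
        have := congrArg Subtype.val (LinearMap.congr_fun (t1 a b ha ha' hb hb') ⟨_, hmem⟩)
        rw [k1 a ha ha', k1 b hb hb'] at this
        simp only [Module.End.mul_apply, LinearMap.zero_apply]
        rw [LinearMap.sub_apply (C a), sub_eq_zero]
        exact this
  exact key _ le_rfl

end final

section Ypart

variable {V : Type} [AddCommGroup V] [Module ℂ V]

/-- A standard-type vector forces dimension at most `m`. -/
theorem standard_bound [FiniteDimensional ℂ V] {m : ℕ} {C : ℕ → End ℂ V} (h : BRep m C)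
    (hm : 2 ≤ m) (hirr : Irr m C) (x : V) (hx : x ≠ 0) (t : ℂ)
    (hf : ∀ j, 2 ≤ j → j < m → C j x = x) (ht : C 1 (C 1 x) = t • x) : finrank ℂ V ≤ m := by
  let f : ℕ → V := fun i => Nat.rec x (fun i y => C (i + 1) y) i
  have f0 : f 0 = x := rfl
  have fs : ∀ i, f (i + 1) = C (i + 1) (f i) := fun i => rfl
  have hcc : ∀ i j, 1 ≤ i → i + 2 ≤ j → j < m → ∀ v, C i (C j v) = C j (C i v) := by
    intro i j h1 h2 h3 v
    exact LinearMap.congr_fun (h.comm i j h1 h2 h3) v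
  have hbr : ∀ i, 1 ≤ i → i + 1 < m → ∀ v,
      C i (C (i + 1) (C i v)) = C (i + 1) (C i (C (i + 1) v)) := by
    intro i h1 h2 v
    exact LinearMap.congr_fun (h.braid i h1 h2) v
  have hR : ∀ i, i < m → ∀ j, 1 ≤ j → j < m → j ≠ i → j ≠ i + 1 → C j (f i) = f i := by
    intro i
    induction i using Nat.strong_induction_on with
    | _ i ih =>
    intro him j h1 h2 h3 h4
    rcases Nat.eq_zero_or_pos i with rfl | hi
    · exact hf j (by omega) h2
    obtain ⟨i, rfl⟩ : ∃ i', i = i' + 1 := ⟨i - 1, by omega⟩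
    rw [fs]
    rcases (show i + 3 ≤ j ∨ j + 1 ≤ i ∨ j = i by omega) with hj | hj | rfl
    · rw [← hcc (i + 1) j (by omega) (by omega) h2, ih i (by omega) (by omega) j h1 h2 (by omega)
        (by omega)]
    · rw [hcc j (i + 1) (by omega) (by omega) him, ih i (by omega) (by omega) j h1 h2 (by omega)
        (by omega)]
    · obtain ⟨i, rfl⟩ : ∃ i', j = i' + 1 := ⟨j - 1, by omega⟩
      rw [fs, hbr (i + 1) (by omega) (by omega),
        ih i (by omega) (by omega) (i + 1 + 1) (by omega) (by omega) (by omega) (by omega)]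
  have hQ : ∀ i, i + 1 < m → C (i + 1) (f (i + 1)) = t • f i := by
    intro i
    induction i with
    | zero => intro _; exact ht
    | succ i ih =>
      intro him
      have hi := ih (by omega)
      rw [fs] at hi
      have hr := hR i (by omega) (i + 1 + 1) (by omega) (by omega) (by omega) (by omega)
      rw [fs (i + 1), fs i]
      nth_rewrite 1 [← hr]
      rw [← hbr (i + 1) (by omega) (by omega), ← hbr (i + 1) (by omega) (by omega), hi, map_smul,
        map_smul, hr]
  apply finrank_le_of_inv hirr m f 0 (by omega) hx
  intro j h1 h2 i hi
  have hmem : ∀ i, i < m → f i ∈ Submodule.span ℂ (Set.image f (Set.Iio m)) := by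
    intro i hi
    exact Submodule.subset_span ⟨i, hi, rfl⟩
  by_cases e1 : j = i
  · subst e1
    obtain ⟨i, rfl⟩ : ∃ i', j = i' + 1 := ⟨j - 1, by omega⟩
    rw [hQ i h2]
    exact Submodule.smul_mem _ _ (hmem _ (by omega))
  by_cases e2 : j = i + 1
  · subst e2
    rw [← fs]
    exact hmem _ h2
  rw [hR i hi j h1 h2 e1 e2]
  exact hmem _ hi

/-- The basic operator measuring the deviation from a Burau-type representation. -/
def Yop (a b : End ℂ V) : End ℂ V := (a - 1) + (a - 1) * (a - 1) + (a - 1) * (b - 1) * (a - 1)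

theorem Yop_symm {a b : End ℂ V} (h : a * b * a = b * a * b) : Yop a b = Yop b a := braid_A h

theorem Yop_conj {a b c Q : End ℂ V} (h1 : Q * a = b * Q) (h2 : Q * b = c * Q) :
    Q * Yop a b = Yop b c * Q := by
  have e1 : Q * (a - 1) = (b - 1) * Q := by rw [mul_sub, sub_mul, h1, mul_one, one_mul]
  have e2 : Q * (b - 1) = (c - 1) * Q := by rw [mul_sub, sub_mul, h2, mul_one, one_mul]
  unfold Yop
  rw [mul_add, mul_add, add_mul, add_mul, e1, ← mul_assoc Q, e1, mul_assoc _ Q, e1,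
    ← mul_assoc Q, ← mul_assoc Q, e1, mul_assoc _ Q, e2, mul_assoc _ _ (a - 1),
    mul_assoc _ Q, e1]
  simp only [mul_assoc]

theorem conj3 {a b c : End ℂ V} (hab : a * b * a = b * a * b) (hbc : b * c * b = c * b * c)
    (hac : a * c = c * a) :
    (a * b * c) * a = b * (a * b * c) ∧ (a * b * c) * b = c * (a * b * c) := by
  constructor
  · rw [mul_assoc, ← hac, ← mul_assoc, hab]; simp only [mul_assoc]
  · rw [mul_assoc a, mul_assoc a, hbc, ← mul_assoc, ← mul_assoc, hac]; simp only [mul_assoc]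

/-- Burau type: dimension at most `m - 1`. -/
theorem burau_bound [FiniteDimensional ℂ V] {m : ℕ} {C : ℕ → End ℂ V} (h : BRep m C)
    (hm : 3 ≤ m) (hirr : Irr m C) (hnt : ¬ Triv m C)
    (hz : ∀ i j, 1 ≤ i → i + 2 ≤ j → j < m → (C i - 1) * (C j - 1) = 0)
    (hY : Yop (C 1) (C 2) = 0) : finrank ℂ V ≤ m - 1 := by
  have hY' : ∀ i, 1 ≤ i → i + 1 < m → Yop (C i) (C (i + 1)) = 0 := by
    intro i hi
    induction i, hi using Nat.le_induction with
    | base => intro _; exact hY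
    | succ i hi ih =>
      intro him
      have hq := conj3 (h.braid i hi (by omega)) (h.braid (i + 1) (by omega) him)
        (h.comm i (i + 1 + 1) hi (by omega) him)
      have := Yop_conj hq.1 hq.2
      rw [ih (by omega), mul_zero] at this
      have hinj : Function.Injective (C i * C (i + 1) * C (i + 1 + 1)) :=
        ((h.inj i hi (by omega)).comp (h.inj (i + 1) (by omega) (by omega))).comp
          (h.inj (i + 1 + 1) (by omega) (by omega))
      have hsurj := LinearMap.injective_iff_surjective.mp hinj
      ext v
      obtain ⟨w, rfl⟩ := hsurj v
      exact (LinearMap.congr_fun this w).symm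
  set A : ℕ → End ℂ V := fun i => C i - 1 with hA
  have hCA : ∀ i v, C i v = v + A i v := by intro i v; simp [hA]
  have hz1 : ∀ i j, 1 ≤ i → i + 2 ≤ j → j < m → ∀ v, A i (A j v) = 0 := by
    intro i j h1 h2 h3 v
    exact LinearMap.congr_fun (hz i j h1 h2 h3) v
  have hz2 : ∀ i j, 1 ≤ i → i + 2 ≤ j → j < m → ∀ v, A j (A i v) = 0 := by
    intro i j h1 h2 h3 v
    have e : (C i - 1) * (C j - 1) = (C j - 1) * (C i - 1) := by
      simp only [mul_sub, sub_mul, h.comm i j h1 h2 h3]; noncomm_ring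
    have := hz i j h1 h2 h3
    rw [e] at this
    exact LinearMap.congr_fun this v
  have hy1 : ∀ i, 1 ≤ i → i + 1 < m → ∀ v, A i v + A i (A i v) + A i (A (i + 1) (A i v)) = 0 := by
    intro i h1 h2 v
    exact LinearMap.congr_fun (hY' i h1 h2) v
  have hy2 : ∀ i, 1 ≤ i → i + 1 < m → ∀ v,
      A (i + 1) v + A (i + 1) (A (i + 1) v) + A (i + 1) (A i (A (i + 1) v)) = 0 := by
    intro i h1 h2 v
    have := hY' i h1 h2
    rw [Yop_symm (h.braid i h1 h2)] at this
    exact LinearMap.congr_fun this v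
  -- an eigenvector of `A 1` in its range
  have hrange : ∀ v ∈ LinearMap.range (A 1), A 1 v ∈ LinearMap.range (A 1) :=
    fun v _ => ⟨v, rfl⟩
  have hne : Nontrivial (LinearMap.range (A 1)) := by
    rw [Submodule.nontrivial_iff_ne_bot]
    intro hb
    rw [LinearMap.range_eq_bot] at hb
    apply hnt
    apply triv_of_eq h (k := 1) le_rfl (by omega)
    apply eq_of_A_mul_zero h le_rfl (by omega)
    change A 1 * _ = 0
    rw [hb, zero_mul]
  obtain ⟨α, hα⟩ := Module.End.exists_eigenvalue ((A 1).restrict hrange)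
  obtain ⟨x, hx⟩ := hα.exists_hasEigenvector
  have hx1 : A 1 (x : V) = α • (x : V) := by
    have := congrArg Subtype.val hx.apply_eq_smul
    simpa using this
  have hx0 : (x : V) ≠ 0 := by
    intro h0; exact hx.2 (Subtype.ext h0)
  let f : ℕ → V := fun i => Nat.rec (x : V) (fun i y => A (i + 2) y) i
  have fs : ∀ i, f (i + 1) = A (i + 2) (f i) := fun i => rfl
  have hfr : ∀ i, ∃ w, f i = A (i + 1) w := by
    intro i
    rcases i with _ | i
    · obtain ⟨w, hw⟩ := x.2
      exact ⟨w, hw.symm⟩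
    · exact ⟨f i, rfl⟩
  have hdown : ∀ i, i + 2 < m → A (i + 1) (f i) = α • f i →
      A (i + 1) (f (i + 1)) = (-(1 + α)) • f i := by
    intro i him hi
    obtain ⟨w, hw⟩ := hfr i
    have := hy1 (i + 1) (by omega) (by omega) w
    rw [← hw, hi] at this
    rw [fs, neg_smul, add_smul, one_smul]
    rw [add_comm] at this
    exact eq_neg_of_add_eq_zero_left this
  have heig : ∀ i, i + 1 < m → A (i + 1) (f i) = α • f i := by
    intro i
    induction i with
    | zero => intro _; exact hx1
    | succ i ih =>
      intro him
      have h1 := hdown i him (ih (by omega))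
      have := hy2 (i + 1) (by omega) (by omega) (f i)
      rw [← fs i, h1, map_smul, ← fs i] at this
      rw [neg_smul, add_smul, one_smul] at this
      have e : ∀ p q r : V, p + q + -(p + r) = 0 → q = r := by
        intro p q r hh
        have : p + q + -(p + r) = q - r := by abel
        rw [this] at hh
        exact sub_eq_zero.mp hh
      exact e _ _ _ this
  have hfar : ∀ i, i + 1 < m → ∀ j, 1 ≤ j → j < m → j ≠ i → j ≠ i + 1 → j ≠ i + 2 →
      A j (f i) = 0 := by
    intro i him j h1 h2 h3 h4 h5
    obtain ⟨w, hw⟩ := hfr i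
    rw [hw]
    rcases (show j + 2 ≤ i + 1 ∨ i + 1 + 2 ≤ j by omega) with hj | hj
    · exact hz1 j (i + 1) h1 hj him w
    · exact hz2 (i + 1) j (by omega) hj h2 w
  apply finrank_le_of_inv hirr (m - 1) f 0 (by omega) hx0
  intro j h1 h2 i hi
  have hmem : ∀ i, i < m - 1 → f i ∈ Submodule.span ℂ (Set.image f (Set.Iio (m - 1))) := by
    intro i hi
    exact Submodule.subset_span ⟨i, hi, rfl⟩
  rw [hCA]
  refine Submodule.add_mem _ (hmem i hi) ?_
  by_cases e1 : j = i
  · subst e1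
    obtain ⟨i, rfl⟩ : ∃ i', j = i' + 1 := ⟨j - 1, by omega⟩
    rw [hdown i (by omega) (heig i (by omega))]
    exact Submodule.smul_mem _ _ (hmem _ (by omega))
  by_cases e2 : j = i + 1
  · subst e2
    rw [heig i h2]
    exact Submodule.smul_mem _ _ (hmem _ hi)
  by_cases e3 : j = i + 2
  · subst e3
    rw [← fs]
    exact hmem (i + 1) (by omega)
  rw [hfar i (by omega) j h1 h2 e1 e2 e3]
  exact Submodule.zero_mem _

/-- Standard type: dimension at most `m`. -/
theorem standard_case [FiniteDimensional ℂ V] {m : ℕ} {C : ℕ → End ℂ V} (h : BRep m C)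
    (hm : 4 ≤ m) (hirr : Irr m C)
    (hz : ∀ i j, 1 ≤ i → i + 2 ≤ j → j < m → (C i - 1) * (C j - 1) = 0)
    (hY : Yop (C 1) (C 2) ≠ 0) : finrank ℂ V ≤ m := by
  have b12 := h.braid 1 (by omega) (by omega)
  have b23 := h.braid 2 (by omega) (by omega)
  have c13 := h.comm 1 3 (by omega) (by omega) (by omega)
  simp only [Nat.reduceAdd] at b12 b23
  have hz2 : ∀ i j, 1 ≤ i → i + 2 ≤ j → j < m → (C j - 1) * (C i - 1) = 0 := by
    intro i j h1 h2 h3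
    have e : (C i - 1) * (C j - 1) = (C j - 1) * (C i - 1) := by
      simp only [mul_sub, sub_mul, h.comm i j h1 h2 h3]; noncomm_ring
    rw [← e]; exact hz i j h1 h2 h3
  have i1 := h.inj 1 (by omega) (by omega)
  have i2 := h.inj 2 (by omega) (by omega)
  have i3 := h.inj 3 (by omega) (by omega)
  -- `d` kills the image of `Yop a b` when `(d-1)(a-1) = 0`
  have kill : ∀ (a b d : End ℂ V), (d - 1) * (a - 1) = 0 → ∀ w, d (Yop a b w) = Yop a b w := by
    intro a b d hd w
    have : (d - 1) * Yop a b = 0 := by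
      unfold Yop
      rw [mul_add, mul_add, mul_assoc (a - 1), ← mul_assoc, ← mul_assoc, hd]
      simp
    have := LinearMap.congr_fun this w
    simp only [Module.End.mul_apply, LinearMap.sub_apply, Module.End.one_apply,
      LinearMap.zero_apply] at this
    exact sub_eq_zero.mp this
  have k3 : ∀ j, 3 ≤ j → j < m → ∀ w, C j (Yop (C 1) (C 2) w) = Yop (C 1) (C 2) w := by
    intro j h1 h2 w
    exact kill _ _ _ (hz2 1 j (by omega) (by omega) h2) w
  have k4 : ∀ j, 4 ≤ j → j < m → ∀ w, C j (Yop (C 2) (C 3) w) = Yop (C 2) (C 3) w := by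
    intro j h1 h2 w
    exact kill _ _ _ (hz2 2 j (by omega) (by omega) h2) w
  have k1 : ∀ w, C 1 (Yop (C 2) (C 3) w) = Yop (C 2) (C 3) w := by
    intro w
    rw [Yop_symm b23]
    exact kill _ _ _ (hz 1 3 (by omega) (by omega) (by omega)) w
  obtain ⟨q1, q2⟩ := conj3 b12 b23 c13
  obtain ⟨p1, p2⟩ := conj3 b23.symm b12.symm c13.symm
  have hQ := Yop_conj q1 q2
  have hQ' := Yop_conj p1 p2
  rw [Yop_symm b23.symm, Yop_symm b12.symm] at hQ'
  have m32 : ∀ w, ∃ w', C 2 (Yop (C 2) (C 3) w) = Yop (C 1) (C 2) w' := by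
    intro w
    refine ⟨(C 3 * C 2 * C 1) w, ?_⟩
    apply i3
    rw [k3 3 le_rfl (by omega)]
    have := LinearMap.congr_fun hQ' w
    simp only [Module.End.mul_apply] at this ⊢
    rw [← this, k1]
  have m23 : ∀ w, ∃ w', C 2 (Yop (C 1) (C 2) w) = Yop (C 2) (C 3) w' := by
    intro w
    refine ⟨(C 1 * C 2 * C 3) w, ?_⟩
    apply i1
    rw [k1]
    have := LinearMap.congr_fun hQ w
    simp only [Module.End.mul_apply] at this ⊢
    rw [← this, k3 3 le_rfl (by omega)]
  have hne : Nontrivial (LinearMap.range (Yop (C 2) (C 3))) := by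
    rw [Submodule.nontrivial_iff_ne_bot]
    intro hb
    rw [LinearMap.range_eq_bot] at hb
    apply hY
    rw [hb, zero_mul] at hQ
    have hinj : Function.Injective (C 1 * C 2 * C 3) := (i1.comp i2).comp i3
    apply end_cancel hinj
    rw [hQ, mul_zero]
  have hinv : ∀ v ∈ LinearMap.range (Yop (C 2) (C 3)),
      (C 2 * C 2) v ∈ LinearMap.range (Yop (C 2) (C 3)) := by
    rintro _ ⟨w, rfl⟩
    obtain ⟨w', hw'⟩ := m32 w
    obtain ⟨w'', hw''⟩ := m23 w'
    exact ⟨w'', by rw [Module.End.mul_apply, hw', hw'']⟩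
  obtain ⟨t, hα⟩ := Module.End.exists_eigenvalue ((C 2 * C 2).restrict hinv)
  obtain ⟨x, hx⟩ := hα.exists_hasEigenvector
  have hx1 : C 2 (C 2 (x : V)) = t • (x : V) := by
    have := congrArg Subtype.val hx.apply_eq_smul
    simpa using this
  have hx0 : (x : V) ≠ 0 := by
    intro h0; exact hx.2 (Subtype.ext h0)
  obtain ⟨w, hw⟩ := x.2
  have x1 : C 1 (x : V) = x := by rw [← hw]; exact k1 w
  have x4 : ∀ j, 4 ≤ j → j < m → C j (x : V) = x := by
    intro j h1 h2; rw [← hw]; exact k4 j h1 h2 w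
  have x3 : C 3 (C 2 (x : V)) = C 2 x := by
    obtain ⟨w', hw'⟩ := m32 w
    rw [hw] at hw'
    rw [hw']; exact k3 3 le_rfl (by omega) w'
  have b12v : ∀ v, C 1 (C 2 (C 1 v)) = C 2 (C 1 (C 2 v)) := fun v => LinearMap.congr_fun b12 v
  have hcc : ∀ i j, 1 ≤ i → i + 2 ≤ j → j < m → ∀ v, C i (C j v) = C j (C i v) := by
    intro i j h1 h2 h3 v
    exact LinearMap.congr_fun (h.comm i j h1 h2 h3) v
  apply standard_bound h (by omega) hirr (C 1 (C 2 (x : V))) _ t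
  · intro j h1 h2
    rcases (show j = 2 ∨ j = 3 ∨ 4 ≤ j by omega) with rfl | rfl | hj
    · rw [← b12v, x1]
    · rw [← hcc 1 3 (by omega) (by omega) h2, x3]
    · rw [← hcc 1 j (by omega) (by omega) h2, ← hcc 2 j (by omega) (by omega) h2, x4 j hj h2]
  · have : C 1 (C 1 (C 2 (x : V))) = t • C 2 (x : V) := by
      nth_rewrite 1 [← x1]
      rw [b12v, b12v, hx1, map_smul, map_smul, x1]
    rw [this, map_smul]
  · intro h0
    apply hx0
    apply i2
    apply i1
    rw [h0]; simp

theorem no_irr [FiniteDimensional ℂ V] {n : ℕ} {C : ℕ → End ℂ V} (h : BRep n C)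
    (hn : 10 ≤ n) (hirr : Irr n C) (h1 : n + 1 ≤ finrank ℂ V) (h2 : finrank ℂ V ≤ 2 * n - 9) :
    False := by
  have hV : Nontrivial V := by
    apply Module.nontrivial_of_finrank_pos (R := ℂ); omega
  have hnt : ¬ Triv n C := by
    intro ht
    obtain ⟨μ, hμ⟩ := Module.End.exists_eigenvalue (C 1)
    obtain ⟨k, hk⟩ := hμ.exists_hasEigenvector
    have := finrank_le_one_of_line hirr hk.2 (fun j h1 h2 => ⟨μ, by
      rw [ht j 1 h1 h2 le_rfl (by omega)]; exact hk.apply_eq_smul⟩)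
    omega
  obtain ⟨m, rfl⟩ : ∃ m, n = m + 2 := ⟨n - 2, by omega⟩
  have hP := pd_main m (by omega)
  obtain ⟨μ, hμ⟩ := exists_large_eigen h (by omega) hP hnt
  obtain ⟨C', hC', hirr', hnt', hk⟩ := normalise h (by omega) hirr hnt μ (by omega)
  rw [← hk] at hμ
  have e := LinearMap.finrank_range_add_finrank_ker (C' 1 - 1 : End ℂ V)
  have hz := far_zero hC' hirr' (by omega) hP (by omega) (not_inj_of_ker (by omega))
  by_cases hY : Yop (C' 1) (C' 2) = 0
  · have := burau_bound hC' (by omega) hirr' hnt' hz hY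
    omega
  · have := standard_case hC' (by omega) hirr' hz hY
    omega

end Ypart

end BraidRed

/-- (Reduction Theorem) For `n ≥ 10`, every irreducible representation of `B_n` of
dimension `r` with `n+1 ≤ r ≤ 2n-9` is a tensor product of a one-dimensional
representation `χ(y)` and an irreducible representation of dimension `r` and corank
`k` with `3 ≤ k ≤ n - 7`. -/
theorem stmt_4 (n r : ℕ) (hn : 10 ≤ n) (hr₁ : n + 1 ≤ r) (hr₂ : r ≤ 2 * n - 9)
    (C : ℕ → Matrix (Fin r) (Fin r) ℂ)
    (hinv : ∀ i, 1 ≤ i → i ≤ n - 1 → IsUnit (C i))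
    (hcomm : ∀ i j, 1 ≤ i → i ≤ n - 1 → 1 ≤ j → j ≤ n - 1 → i + 2 ≤ j →
      C i * C j = C j * C i)
    (hbraid : ∀ i, 1 ≤ i → i ≤ n - 2 →
      C i * C (i + 1) * C i = C (i + 1) * C i * C (i + 1))
    (hirr : ∀ p : Submodule ℂ (Fin r → ℂ),
      (∀ i, 1 ≤ i → i ≤ n - 1 → ∀ v ∈ p, (C i).mulVec v ∈ p) → p = ⊥ ∨ p = ⊤) :
    ∃ (y : ℂ) (k : ℕ) (D : ℕ → Matrix (Fin r) (Fin r) ℂ), y ≠ 0 ∧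
      3 ≤ k ∧ k ≤ n - 7 ∧
      (∀ i, 1 ≤ i → i ≤ n - 1 → IsUnit (D i)) ∧
      (∀ i j, 1 ≤ i → i ≤ n - 1 → 1 ≤ j → j ≤ n - 1 → i + 2 ≤ j →
        D i * D j = D j * D i) ∧
      (∀ i, 1 ≤ i → i ≤ n - 2 →
        D i * D (i + 1) * D i = D (i + 1) * D i * D (i + 1)) ∧
      (∀ p : Submodule ℂ (Fin r → ℂ),
        (∀ i, 1 ≤ i → i ≤ n - 1 → ∀ v ∈ p, (D i).mulVec v ∈ p) → p = ⊥ ∨ p = ⊤) ∧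
      (D 1 - 1).rank = k ∧
      (∀ i, 1 ≤ i → i ≤ n - 1 → C i = y • D i) := by
  exfalso
  refine BraidRed.no_irr (V := Fin r → ℂ) (n := n) (C := fun i => Matrix.mulVecLin (C i))
    ⟨?_, ?_, ?_⟩ hn ?_ ?_ ?_
  · intro i h1 h2
    exact Matrix.mulVec_injective_of_isUnit (hinv i h1 (by omega))
  · intro i j h1 h2 h3
    have := hcomm i j h1 (by omega) (by omega) (by omega) h2
    rw [Module.End.mul_eq_comp, Module.End.mul_eq_comp, ← Matrix.mulVecLin_mul,
      ← Matrix.mulVecLin_mul, this]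
  · intro i h1 h2
    have := hbraid i h1 (by omega)
    simp only [Module.End.mul_eq_comp, ← Matrix.mulVecLin_mul]
    rw [this]
  · intro p hp
    apply hirr p
    intro i h1 h2 v hv
    exact hp i h1 (by omega) v hv
  · simpa using hr₁
  · simpa using hr₂
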